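/- The lattice NC_5 of noncrossing partitions of Fin 5 contains no global spindle of girth 6 whose elements' ranks alternate between r and r + 1 for some r ∈ {1, 2, 3}. (Together with the characterization of short spindles in rank-4 lattices, this shows NC_5 has no short spindles.) -/

import Mathlib

/-- A partition (setoid) of `Fin n` is noncrossing if there are no indices
`a < b < c < d` with `a ~ c` and `b ~ d` but `a ≁ b`. -/
def IsNoncrossing {n : ℕ} (s : Setoid (Fin n)) : Prop :=
  ∀ a b c d : Fin n, a < b → b < c → c < d → s.r a c → s.r b d → s.r a b

/-- The poset `NC n` of noncrossing partitions of `Fin n`, ordered by refinement. -/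
def NC (n : ℕ) : Type := {s : Setoid (Fin n) // IsNoncrossing s}

noncomputable instance (n : ℕ) : PartialOrder (NC n) :=
  Subtype.partialOrder _

/-- The discrete partition (equality), the bottom of `NC n`. -/
def ncBot (n : ℕ) : NC n :=
  ⟨⟨Eq, eq_equivalence⟩, by
    intro a b c d hab hbc _ hac _
    exact absurd (hab.trans hbc) (by rw [show a = c from hac]; exact lt_irrefl c)⟩

/-- The partition with a single block, the top of `NC n`. -/
def ncTop (n : ℕ) : NC n :=
  ⟨⟨fun _ _ => True, ⟨fun _ => trivial, fun _ => trivial, fun _ _ => trivial⟩⟩,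
    fun _ _ _ _ _ _ _ _ _ => trivial⟩

/-- The rank of a noncrossing partition of `Fin n`: `n` minus its number of blocks. -/
noncomputable def ncRank {n : ℕ} (s : NC n) : ℕ := n - Nat.card (Quotient s.1)

/-- `x` and `y` are complements in the interval `[z, w]`. -/
def ComplementsIn {P : Type*} [PartialOrder P] (z w x y : P) : Prop :=
  z ≤ x ∧ x ≤ w ∧ z ≤ y ∧ y ≤ w ∧
  (∀ u, z ≤ u → u ≤ w → x ≤ u → y ≤ u → u = w) ∧
  (∀ u, z ≤ u → u ≤ w → u ≤ x → u ≤ y → u = z)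

/-- A spindle of girth `2k` in the interval `[z, w]` (a global spindle when `z`, `w`
are the bottom and top). -/
def IsSpindleIn {P : Type*} [PartialOrder P] (z w : P) (k : ℕ) (x : ℤ → P) : Prop :=
  2 ≤ k ∧
  (∀ i : ℤ, x (i + 2 * k) = x i) ∧
  (∀ i j : ℤ, 0 ≤ i → i < 2 * k → 0 ≤ j → j < 2 * k → x i = x j → i = j) ∧
  (∀ i : ℤ, z ≤ x i ∧ x i ≤ w ∧ x i ≠ z ∧ x i ≠ w) ∧
  (((∀ i : ℤ, Even i → ComplementsIn z (x i) (x (i - 1)) (x (i + 1))) ∧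
    (∀ i : ℤ, Odd i → ComplementsIn (x i) w (x (i - 1)) (x (i + 1)))) ∨
   ((∀ i : ℤ, Odd i → ComplementsIn z (x i) (x (i - 1)) (x (i + 1))) ∧
    (∀ i : ℤ, Even i → ComplementsIn (x i) w (x (i - 1)) (x (i + 1)))))

theorem IsNoncrossing.inf {n : ℕ} {s t : Setoid (Fin n)} (hs : IsNoncrossing s)
    (ht : IsNoncrossing t) : IsNoncrossing (s ⊓ t) :=
  fun a b c d hab hbc hcd hac hbd =>
    ⟨hs a b c d hab hbc hcd hac.1 hbd.1, ht a b c d hab hbc hcd hac.2 hbd.2⟩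

/-- The meet of two noncrossing partitions. -/
def ncInf {n : ℕ} (s t : NC n) : NC n := ⟨s.1 ⊓ t.1, s.2.inf t.2⟩

theorem ncInf_le_left {n : ℕ} (s t : NC n) : ncInf s t ≤ s :=
  show s.1 ⊓ t.1 ≤ s.1 from inf_le_left

theorem ncInf_le_right {n : ℕ} (s t : NC n) : ncInf s t ≤ t :=
  show s.1 ⊓ t.1 ≤ t.1 from inf_le_right

theorem le_ncInf {n : ℕ} {s t u : NC n} (hs : u ≤ s) (ht : u ≤ t) : u ≤ ncInf s t :=
  show u.1 ≤ s.1 ⊓ t.1 from le_inf hs ht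

theorem le_ncTop {n : ℕ} (s : NC n) : s ≤ ncTop n := fun _ _ _ => trivial

theorem ComplementsIn.ncInf_eq {n : ℕ} {z w x y : NC n} (h : ComplementsIn z w x y) :
    ncInf x y = z :=
  h.2.2.2.2.2 _ (le_ncInf h.1 h.2.2.1) ((ncInf_le_left _ _).trans h.2.1)
    (ncInf_le_left _ _) (ncInf_le_right _ _)

theorem ComplementsIn.le_of_le {n : ℕ} {z w x y t : NC n} (h : ComplementsIn z w x y)
    (hx : x ≤ t) (hy : y ≤ t) : w ≤ t := by
  have hw := h.2.2.2.2.1 (ncInf t w) (h.1.trans (le_ncInf hx h.2.1)) (ncInf_le_right _ _)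
    (le_ncInf hx h.2.1) (le_ncInf hy h.2.2.2.1)
  exact hw ▸ ncInf_le_left t w

theorem ncRank_mono {n : ℕ} {s t : NC n} (h : s ≤ t) : ncRank s ≤ ncRank t := by
  have : Nat.card (Quotient t.1) ≤ Nat.card (Quotient s.1) := by
    refine Nat.card_le_card_of_surjective (Quotient.map id fun a b hab => h hab) ?_
    rintro ⟨a⟩
    exact ⟨Quotient.mk _ a, rfl⟩
  unfold ncRank
  lia

/-- The blocks of a partition of rank `r` can be labelled by `Fin k` with `k + r = n`. -/
theorem exists_coloring {n k r : ℕ} {s : NC n} (hs : ncRank s = r) (hk : k + r = n)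
    (hr : r ≠ 0) :
    ∃ f : Fin n → Fin k, Function.Surjective f ∧ ∀ a b, s.1.r a b ↔ f a = f b := by
  have hcard : Nat.card (Quotient s.1) = k := by
    unfold ncRank at hs
    lia
  let e := Finite.equivFinOfCardEq hcard
  refine ⟨fun a => e (Quotient.mk _ a), e.surjective.comp Quotient.mk_surjective, fun a b => ?_⟩
  rw [e.apply_eq_iff_eq]
  exact Quotient.eq.symm

/-- A surjection onto a set with one element fewer identifies exactly one pair. -/
theorem exists_unique_collision {n : ℕ} {f : Fin (n + 1) → Fin n} (hf : Function.Surjective f) :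
    ∃ p q, p < q ∧ f p = f q ∧
      ∀ a b, f a = f b → a = b ∨ (a = p ∧ b = q) ∨ (a = q ∧ b = p) := by
  obtain ⟨p, q, hpq, hne⟩ : ∃ p q, f p = f q ∧ p ≠ q := by
    by_contra! h
    have := Fintype.card_le_of_injective f fun a b hab => h a b hab
    simp at this
  wlog hlt : p < q generalizing p q
  · exact this q p hpq.symm hne.symm (lt_of_le_of_ne (not_lt.mp hlt) hne.symm)
  have key : ∀ p q, f p = f q → p ≠ q → ∀ a b, a ≠ p → b ≠ p → f a = f b → a = b := by
    intro p q hpq hne a b ha hb hab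
    have himg : (Finset.univ.erase p).image f = Finset.univ := by
      ext y
      obtain ⟨x, rfl⟩ := hf y
      simp only [Finset.mem_image, Finset.mem_erase, Finset.mem_univ, and_true, iff_true]
      by_cases hx : x = p
      · exact ⟨q, hne.symm, by rw [hx, hpq]⟩
      · exact ⟨x, hx, rfl⟩
    have hinj : Set.InjOn f (Finset.univ.erase p : Finset (Fin (n + 1))) := by
      rw [← Finset.card_image_iff, himg]
      simp
    exact hinj (by simpa using ha) (by simpa using hb) hab
  refine ⟨p, q, hlt, hpq, fun a b hab => ?_⟩
  have h₁ := key p q hpq hne a b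
  have h₂ := key q p hpq.symm hne.symm a b
  grind

/-- Three lines of the cube in the three coordinate directions cover at least four vertices. -/
theorem card_cube_avoiding_le (u v w : Fin 2 × Fin 2) :
    (Finset.univ.filter fun x : Fin 2 × Fin 2 × Fin 2 =>
      (x.1, x.2.1) ≠ u ∧ (x.2.1, x.2.2) ≠ v ∧ (x.2.2, x.1) ≠ w).card ≤ 4 := by
  revert u v w
  decide

/-- Two coatoms of `NC 5` whose meet has three blocks miss a pair of labels. -/
theorem exists_missing_pair {b c d : NC 5} {f g : Fin 5 → Fin 2} (hb : ncRank b = 2)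
    (hf : ∀ x y, c.1.r x y ↔ f x = f y) (hg : ∀ x y, d.1.r x y ↔ g x = g y)
    (hbc : b ≤ c) (hbd : b ≤ d) : ∃ u : Fin 2 × Fin 2, ∀ x, (f x, g x) ≠ u := by
  obtain ⟨h, -, hh⟩ := exists_coloring (k := 3) hb rfl (by decide)
  by_contra! hsurj
  choose σ hσ using hsurj
  have hinj : Function.Injective (h ∘ σ) := by
    intro u v huv
    have hr := (hh _ _).mpr huv
    rw [← hσ u, ← hσ v, (hf _ _).mp (hbc hr), (hg _ _).mp (hbd hr)]
  have := Fintype.card_le_of_injective _ hinj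
  simp at this

theorem no_hexagon_of_coatoms {b₁ b₂ b₃ c₁ c₂ c₃ : NC 5}
    (hb₁ : ncRank b₁ = 2) (hb₂ : ncRank b₂ = 2) (hb₃ : ncRank b₃ = 2)
    (hc₁ : ncRank c₁ = 3) (hc₂ : ncRank c₂ = 3) (hc₃ : ncRank c₃ = 3)
    (h₁ : ComplementsIn b₁ (ncTop 5) c₁ c₂) (h₂ : ComplementsIn b₂ (ncTop 5) c₂ c₃)
    (h₃ : ComplementsIn b₃ (ncTop 5) c₃ c₁) (h : ComplementsIn (ncBot 5) c₂ b₁ b₂) : False := by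
  obtain ⟨f₁, -, hf₁⟩ := exists_coloring (k := 2) hc₁ rfl (by decide)
  obtain ⟨f₂, -, hf₂⟩ := exists_coloring (k := 2) hc₂ rfl (by decide)
  obtain ⟨f₃, -, hf₃⟩ := exists_coloring (k := 2) hc₃ rfl (by decide)
  obtain ⟨u, hu⟩ := exists_missing_pair hb₁ hf₁ hf₂ h₁.1 h₁.2.2.1
  obtain ⟨v, hv⟩ := exists_missing_pair hb₂ hf₂ hf₃ h₂.1 h₂.2.2.1
  obtain ⟨w, hw⟩ := exists_missing_pair hb₃ hf₃ hf₁ h₃.1 h₃.2.2.1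
  have hinj : Function.Injective fun x => (f₁ x, f₂ x, f₃ x) := by
    intro x y hxy
    simp only [Prod.mk.injEq] at hxy
    have r₁ : b₁.1.r x y := by
      rw [← h₁.ncInf_eq]
      exact ⟨(hf₁ x y).mpr hxy.1, (hf₂ x y).mpr hxy.2.1⟩
    have r₂ : b₂.1.r x y := by
      rw [← h₂.ncInf_eq]
      exact ⟨(hf₂ x y).mpr hxy.2.1, (hf₃ x y).mpr hxy.2.2⟩
    have r : (ncBot 5).1.r x y := by
      rw [← h.ncInf_eq]
      exact ⟨r₁, r₂⟩
    exact r
  have hcard := (Finset.card_image_of_injective Finset.univ hinj).symm.trans_le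
    ((Finset.card_le_card fun z hz => by
      obtain ⟨x, -, rfl⟩ := Finset.mem_image.mp hz
      exact Finset.mem_filter.mpr ⟨Finset.mem_univ _, hu x, hv x, hw x⟩).trans
      (card_cube_avoiding_le u v w))
  simp at hcard

/-- The partition of `Fin n` into an interval and its complement. -/
def intervalCut {n : ℕ} (i j : Fin n) : NC n :=
  ⟨⟨fun a b => (i ≤ a ∧ a ≤ j) ↔ (i ≤ b ∧ b ≤ j),
    ⟨fun _ => Iff.rfl, Iff.symm, Iff.trans⟩⟩, by
    intro a b c d hab hbc hcd hac hbd
    change (_ ↔ _) at hac hbd ⊢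
    lia⟩

theorem no_crossing_of_rank_two {b : NC 5} (hb : ncRank b = 2) {p q p' q' : Fin 5}
    (h : b.1.r p q) (h' : b.1.r p' q') : ¬ (p < p' ∧ p' < q ∧ q < q') := by
  rintro ⟨h₁, h₂, h₃⟩
  have hpp := b.2 p p' q q' h₁ h₂ h₃ h h'
  obtain ⟨f, hf, hfb⟩ := exists_coloring (k := 3) hb rfl (by decide)
  rw [hfb] at h h' hpp
  have hcard : ({p, p', q, q'} : Finset (Fin 5)).card = 4 := by
    grind
  have hsub : (Finset.univ : Finset (Fin 3)) ⊆
      {f p} ∪ ({p, p', q, q'} : Finset (Fin 5))ᶜ.image f := by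
    intro y _
    obtain ⟨x, rfl⟩ := hf y
    by_cases hx : x ∈ ({p, p', q, q'} : Finset (Fin 5))
    · grind
    · exact Finset.mem_union_right _ (Finset.mem_image_of_mem f (Finset.mem_compl.mpr hx))
  have h₄ := (Finset.card_le_card hsub).trans (Finset.card_union_le _ _)
  have h₅ := Finset.card_image_le (s := ({p, p', q, q'} : Finset (Fin 5))ᶜ) (f := f)
  rw [Finset.card_compl, hcard] at h₅
  simp at h₄ h₅
  lia

/-- The chords `p q` and `p' q'`, where `p < q` and `p' < q'`, do not cross. -/
def NoncrossingChords {n : ℕ} (p q p' q' : Fin n) : Prop :=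
  ¬ (p < p' ∧ p' < q ∧ q < q') ∧ ¬ (p' < p ∧ p < q' ∧ q' < q)

instance {n : ℕ} (p q p' q' : Fin n) : Decidable (NoncrossingChords p q p' q') :=
  inferInstanceAs (Decidable (_ ∧ _))

set_option maxRecDepth 100000 in
/-- Three pairwise noncrossing chords of a pentagon leave an interval cut off. -/
theorem exists_cut_of_noncrossing_chords : ∀ p₁ q₁ : Fin 5, p₁ < q₁ → ∀ p₂ q₂ : Fin 5, p₂ < q₂ →
    NoncrossingChords p₁ q₁ p₂ q₂ → ∀ p₃ q₃ : Fin 5, p₃ < q₃ →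
    NoncrossingChords p₂ q₂ p₃ q₃ → NoncrossingChords p₃ q₃ p₁ q₁ →
    ∃ i j : Fin 5, 0 < i ∧ i ≤ j ∧ ((i ≤ p₁ ∧ p₁ ≤ j) ↔ (i ≤ q₁ ∧ q₁ ≤ j)) ∧
      ((i ≤ p₂ ∧ p₂ ≤ j) ↔ (i ≤ q₂ ∧ q₂ ≤ j)) ∧
      ((i ≤ p₃ ∧ p₃ ≤ j) ↔ (i ≤ q₃ ∧ q₃ ≤ j)) := by
  decide

/-- An atom of `NC 5` joins a single pair of points. -/
theorem exists_chord_of_rank_one {a : NC 5} (ha : ncRank a = 1) :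
    ∃ p q, p < q ∧ a.1.r p q ∧ ∀ t : NC 5, t.1.r p q → a ≤ t := by
  obtain ⟨f, hf, hfa⟩ := exists_coloring (k := 4) ha rfl (by decide)
  obtain ⟨p, q, hlt, hpq, huniq⟩ := exists_unique_collision hf
  refine ⟨p, q, hlt, (hfa _ _).mpr hpq, fun t ht x y hxy => ?_⟩
  rcases huniq x y ((hfa x y).mp hxy) with rfl | ⟨rfl, rfl⟩ | ⟨rfl, rfl⟩
  · exact t.1.refl x
  · exact ht
  · exact t.1.symm ht

theorem ComplementsIn.noncrossingChords {z b a a' : NC 5} (h : ComplementsIn z b a a')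
    (hb : ncRank b = 2) {p q p' q' : Fin 5} (hpq : a.1.r p q) (hpq' : a'.1.r p' q') :
    NoncrossingChords p q p' q' :=
  ⟨no_crossing_of_rank_two hb (h.2.1 hpq) (h.2.2.2.1 hpq'),
    no_crossing_of_rank_two hb (h.2.2.2.1 hpq') (h.2.1 hpq)⟩

theorem no_hexagon_of_atoms {a₁ a₂ a₃ b₁ b₂ b₃ : NC 5}
    (ha₁ : ncRank a₁ = 1) (ha₂ : ncRank a₂ = 1) (ha₃ : ncRank a₃ = 1)
    (hb₁ : ncRank b₁ = 2) (hb₂ : ncRank b₂ = 2) (hb₃ : ncRank b₃ = 2)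
    (h₁ : ComplementsIn (ncBot 5) b₁ a₁ a₂) (h₂ : ComplementsIn (ncBot 5) b₂ a₂ a₃)
    (h₃ : ComplementsIn (ncBot 5) b₃ a₃ a₁) (h : ComplementsIn a₂ (ncTop 5) b₁ b₂) : False := by
  obtain ⟨p₁, q₁, hlt₁, hr₁, hle₁⟩ := exists_chord_of_rank_one ha₁
  obtain ⟨p₂, q₂, hlt₂, hr₂, hle₂⟩ := exists_chord_of_rank_one ha₂
  obtain ⟨p₃, q₃, hlt₃, hr₃, hle₃⟩ := exists_chord_of_rank_one ha₃
  obtain ⟨i, j, hi, hij, ht₁, ht₂, ht₃⟩ := exists_cut_of_noncrossing_chords p₁ q₁ hlt₁ p₂ q₂ hlt₂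
    (h₁.noncrossingChords hb₁ hr₁ hr₂) p₃ q₃ hlt₃ (h₂.noncrossingChords hb₂ hr₂ hr₃)
    (h₃.noncrossingChords hb₃ hr₃ hr₁)
  have hle : ncTop 5 ≤ intervalCut i j :=
    h.le_of_le (h₁.le_of_le (hle₁ _ ht₁) (hle₂ _ ht₂)) (h₂.le_of_le (hle₂ _ ht₂) (hle₃ _ ht₃))
  have h0 : (i ≤ 0 ∧ 0 ≤ j) ↔ (i ≤ i ∧ i ≤ j) := hle (show (ncTop 5).1.r 0 i from trivial)
  exact absurd (h0.mpr ⟨le_rfl, hij⟩).1 (not_le.mpr hi)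

theorem eq_ncTop_of_rank_four {s : NC 5} (hs : ncRank s = 4) : s = ncTop 5 := by
  obtain ⟨f, -, hf⟩ := exists_coloring (k := 1) hs rfl (by decide)
  exact le_antisymm (le_ncTop s) fun a b _ => (hf a b).mpr (Subsingleton.elim _ _)

/-- The lower and upper elements of a spindle with alternating ranks `r` and `r + 1`
have ranks `r` and `r + 1` respectively. -/
theorem alternating_ranks {n r : ℕ} {y : ℤ → NC n}
    (hrank : ∀ i : ℤ, (ncRank (y i) = r ∧ ncRank (y (i + 1)) = r + 1) ∨
      (ncRank (y i) = r + 1 ∧ ncRank (y (i + 1)) = r))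
    {i : ℤ} (hle : y (i + 1) ≤ y i) : ncRank (y i) = r + 1 ∧ ncRank (y (i + 1)) = r := by
  have := ncRank_mono hle
  have := hrank i
  lia

theorem no_alternating_hexagon {y : ℤ → NC 5} {r : ℕ} (hper : ∀ i, y (i + 6) = y i)
    (htop : ∀ i, y i ≠ ncTop 5)
    (hdown : ∀ i : ℤ, Even i → ComplementsIn (ncBot 5) (y i) (y (i - 1)) (y (i + 1)))
    (hup : ∀ i : ℤ, Odd i → ComplementsIn (y i) (ncTop 5) (y (i - 1)) (y (i + 1)))
    (hr : r = 1 ∨ r = 2 ∨ r = 3)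
    (hrank : ∀ i : ℤ, (ncRank (y i) = r ∧ ncRank (y (i + 1)) = r + 1) ∨
      (ncRank (y i) = r + 1 ∧ ncRank (y (i + 1)) = r)) : False := by
  have d₀ : ComplementsIn (ncBot 5) (y 0) (y 5) (y 1) := hper (-1) ▸ hdown 0 (by decide)
  have d₂ : ComplementsIn (ncBot 5) (y 2) (y 1) (y 3) := hdown 2 (by decide)
  have d₄ : ComplementsIn (ncBot 5) (y 4) (y 3) (y 5) := hdown 4 (by decide)
  have u₁ : ComplementsIn (y 1) (ncTop 5) (y 0) (y 2) := hup 1 (by decide)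
  have u₃ : ComplementsIn (y 3) (ncTop 5) (y 2) (y 4) := hup 3 (by decide)
  have u₅ : ComplementsIn (y 5) (ncTop 5) (y 4) (y 0) := hper 0 ▸ hup 5 (by decide)
  obtain ⟨r₀, r₁⟩ := alternating_ranks hrank (i := 0) d₀.2.2.2.1
  obtain ⟨r₂, r₃⟩ := alternating_ranks hrank (i := 2) d₂.2.2.2.1
  obtain ⟨r₄, r₅⟩ := alternating_ranks hrank (i := 4) d₄.2.2.2.1
  rcases hr with rfl | rfl | rfl
  · exact no_hexagon_of_atoms r₁ r₃ r₅ r₂ r₄ r₀ d₂ d₄ d₀ u₃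
  · exact no_hexagon_of_coatoms r₁ r₃ r₅ r₀ r₂ r₄ u₁ u₃ u₅ d₂
  · exact htop 0 (eq_ncTop_of_rank_four r₀)

/-- The lattice `NC 5` of noncrossing partitions of `Fin 5` contains no global spindle
of girth `6` whose elements' ranks alternate between `r` and `r + 1` for some
`r ∈ {1, 2, 3}`. -/
theorem nc5_no_alternating_girth_six_spindle :
    ¬ ∃ (x : ℤ → NC 5) (r : ℕ),
        IsSpindleIn (ncBot 5) (ncTop 5) 3 x ∧ (r = 1 ∨ r = 2 ∨ r = 3) ∧
        ∀ i : ℤ, (ncRank (x i) = r ∧ ncRank (x (i + 1)) = r + 1) ∨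
          (ncRank (x i) = r + 1 ∧ ncRank (x (i + 1)) = r) := by
  rintro ⟨x, r, ⟨-, hper, -, hne, hcompl⟩, hr, hrank⟩
  rcases hcompl with ⟨hdown, hup⟩ | ⟨hdown, hup⟩
  · exact no_alternating_hexagon hper (fun i => (hne i).2.2.2) hdown hup hr hrank
  · refine no_alternating_hexagon (y := fun i => x (i + 1)) (r := r) (fun i => ?_)
      (fun i => (hne _).2.2.2) (fun i hi => ?_) (fun i hi => ?_) hr (fun i => hrank (i + 1))
    · have := hper (i + 1)
      rwa [show i + 1 + 2 * ((3 : ℕ) : ℤ) = i + 6 + 1 by norm_num; ring] at this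
    · have := hdown (i + 1) hi.add_one
      rwa [add_sub_right_comm] at this
    · have := hup (i + 1) hi.add_one
      rwa [add_sub_right_comm] at this
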